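/- arXiv:2506.09525 — 3 statements merged into one kernel-verified Lean document; each statement's English description precedes it below -/
import Mathlib

section
/- Let d be a natural number, p, q, δ ∈ EuclideanSpace ℝ (Fin d), and r ∈ ℝ. Set L1 = σ(⟪p, q⟫) − r and L2 = σ(⟪p, q⟫)·(1 − σ(⟪p, q⟫)), and set h = ⟪p, δ⟫. Then the gradient of the binary cross-entropy loss evaluated with the perturbed item embedding q + δ decomposes into the original gradient, a scaling term, a shift term, and a controlled remainder: ‖ (σ(⟪p, q + δ⟫) − r) • (q + δ) − ( L1 • q + (L2 · h) • q + L1 • δ ) ‖ ≤ (1/4)·|h|·‖δ‖ + (h²/8)·(‖q‖ + ‖δ‖). -/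
open scoped RealInnerProductSpace

noncomputable def sigmoid (x : ℝ) : ℝ := 1 / (1 + Real.exp (-x))

theorem aux_hasDeriv (x : ℝ) : HasDerivAt sigmoid (sigmoid x * (1 - sigmoid x)) x := by
  have e : sigmoid = Real.sigmoid := by
    funext y
    simp [sigmoid, Real.sigmoid_def]
  rw [e]
  exact Real.hasDerivAt_sigmoid x

theorem aux_pos (x : ℝ) : 0 < sigmoid x := by
  unfold sigmoid
  positivity

theorem aux_lt (x : ℝ) : sigmoid x < 1 := by
  unfold sigmoid
  rw [div_lt_one (by positivity)]
  linarith [Real.exp_pos (-x)]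

theorem aux_mono (g g' : ℝ → ℝ) (hd : ∀ x, HasDerivAt g (g' x) x) (hp : ∀ x, 0 ≤ g' x) :
    Monotone g :=
  monotone_of_deriv_nonneg (fun x => (hd x).differentiableAt)
    (fun x => by rw [(hd x).deriv]; exact hp x)

theorem aux_tangent (g g' : ℝ → ℝ) (hd : ∀ x, HasDerivAt g (g' x) x) (hm : Monotone g')
    (a b : ℝ) : g' a * (b - a) ≤ g b - g a := by
  have hc : Continuous g := continuous_iff_continuousAt.2 fun x => (hd x).continuousAt
  rcases lt_trichotomy a b with hab | hab | hab
  · obtain ⟨c, hc1, hc2⟩ := exists_hasDerivAt_eq_slope g g' hab hc.continuousOn (fun x _ => hd x)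
    rw [eq_div_iff (by linarith)] at hc2
    rw [← hc2]
    exact mul_le_mul_of_nonneg_right (hm hc1.1.le) (by linarith)
  · subst hab; simp
  · obtain ⟨c, hc1, hc2⟩ := exists_hasDerivAt_eq_slope g g' hab hc.continuousOn (fun x _ => hd x)
    rw [eq_div_iff (by linarith)] at hc2
    have := mul_le_mul_of_nonneg_right (hm hc1.2.le) (sub_nonneg.2 hab.le)
    linarith

theorem aux_lip (a b : ℝ) : |sigmoid b - sigmoid a| ≤ 1 / 4 * |b - a| := by
  have h1 : Monotone sigmoid := aux_mono _ _ aux_hasDeriv fun x =>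
    mul_nonneg (aux_pos x).le (by linarith [aux_lt x])
  have h2 : Monotone (fun x => 1 / 4 * x - sigmoid x) :=
    aux_mono _ (fun x => 1 / 4 * 1 - sigmoid x * (1 - sigmoid x))
      (fun x => ((hasDerivAt_id x).const_mul (1 / 4 : ℝ)).sub (aux_hasDeriv x))
      fun x => by nlinarith [sq_nonneg (sigmoid x - 1 / 2)]
  rcases le_total a b with hab | hab
  · have := h1 hab
    have h3 := h2 hab
    simp only at h3
    rw [abs_of_nonneg (by linarith), abs_of_nonneg (by linarith)]
    linarith
  · have := h1 hab
    have h3 := h2 hab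
    simp only at h3
    rw [abs_of_nonpos (by linarith), abs_of_nonpos (by linarith)]
    linarith

theorem aux_deriv2 (x : ℝ) : HasDerivAt (fun x => sigmoid x * (1 - sigmoid x))
    (sigmoid x * (1 - sigmoid x) * (1 - 2 * sigmoid x)) x := by
  have h := (aux_hasDeriv x).mul ((aux_hasDeriv x).const_sub 1)
  exact h.congr_deriv (by ring)

theorem aux_bound (x : ℝ) : |sigmoid x * (1 - sigmoid x) * (1 - 2 * sigmoid x)| ≤ 1 / 4 := by
  have h0 := aux_pos x
  have h1 := aux_lt x
  have ha : |sigmoid x * (1 - sigmoid x)| ≤ 1 / 4 := by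
    rw [abs_of_nonneg (mul_nonneg h0.le (by linarith))]
    nlinarith [sq_nonneg (sigmoid x - 1 / 2)]
  have hb : |1 - 2 * sigmoid x| ≤ 1 := abs_le.2 ⟨by linarith, by linarith⟩
  rw [abs_mul]
  calc _ ≤ 1 / 4 * (1 : ℝ) := mul_le_mul ha hb (abs_nonneg _) (by norm_num)
    _ = _ := by norm_num

theorem aux_taylor (a b : ℝ) :
    |sigmoid b - sigmoid a - sigmoid a * (1 - sigmoid a) * (b - a)| ≤ (b - a) ^ 2 / 8 := by
  have hsq : ∀ x : ℝ, HasDerivAt (fun x : ℝ => 1 / 8 * x ^ 2) (1 / 4 * x) x := fun x => by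
    have h := (hasDerivAt_pow 2 x).const_mul (1 / 8 : ℝ)
    exact h.congr_deriv (by norm_num; ring)
  have hl : ∀ x : ℝ, HasDerivAt (fun x : ℝ => 1 / 4 * x) (1 / 4 * 1) x := fun x =>
    (hasDerivAt_id x).const_mul (1 / 4 : ℝ)
  have t1 := aux_tangent _ _ (fun x => (hsq x).sub (aux_hasDeriv x))
    (aux_mono _ _ (fun x => (hl x).sub (aux_deriv2 x))
      fun x => by linarith [(abs_le.1 (aux_bound x)).2]) a b
  have t2 := aux_tangent _ _ (fun x => (hsq x).add (aux_hasDeriv x))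
    (aux_mono _ _ (fun x => (hl x).add (aux_deriv2 x))
      fun x => by linarith [(abs_le.1 (aux_bound x)).1]) a b
  simp only [Pi.add_apply, Pi.sub_apply] at t1 t2
  rw [abs_le]
  constructor <;> nlinarith

theorem stmt7 (d : ℕ) (p q δ : EuclideanSpace ℝ (Fin d)) (r : ℝ)
    (L1 L2 h : ℝ)
    (hL1 : L1 = sigmoid ⟪p, q⟫ - r)
    (hL2 : L2 = sigmoid ⟪p, q⟫ * (1 - sigmoid ⟪p, q⟫))
    (hh : h = ⟪p, δ⟫) :
    ‖(sigmoid ⟪p, q + δ⟫ - r) • (q + δ)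
        - (L1 • q + (L2 * h) • q + L1 • δ)‖
      ≤ (1 / 4) * |h| * ‖δ‖ + (h ^ 2 / 8) * (‖q‖ + ‖δ‖) := by
  have e : ⟪p, q + δ⟫ = ⟪p, q⟫ + h := by rw [hh, inner_add_right]
  rw [e]
  have l := aux_lip ⟪p, q⟫ (⟪p, q⟫ + h)
  have t := aux_taylor ⟪p, q⟫ (⟪p, q⟫ + h)
  rw [add_sub_cancel_left] at l t
  rw [← hL2] at t
  have key : (sigmoid (⟪p, q⟫ + h) - r) • (q + δ) - (L1 • q + (L2 * h) • q + L1 • δ)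
      = (sigmoid (⟪p, q⟫ + h) - sigmoid ⟪p, q⟫ - L2 * h) • q
        + (sigmoid (⟪p, q⟫ + h) - sigmoid ⟪p, q⟫) • δ := by
    rw [hL1]
    module
  rw [key]
  refine (norm_add_le _ _).trans ?_
  rw [norm_smul, norm_smul, Real.norm_eq_abs, Real.norm_eq_abs]
  have a1 := mul_le_mul_of_nonneg_right t (norm_nonneg q)
  have a2 := mul_le_mul_of_nonneg_right l (norm_nonneg δ)
  have a3 : 0 ≤ h ^ 2 / 8 * ‖δ‖ := by positivity
  linarith
end

section
/- Let E be a real inner product space, m and T natural numbers, and let η ≥ 0, γ ∈ (0, 1), C1 ≥ 0, C2 ≥ 0 be reals. Let p : ℕ → E, and for each i ∈ Fin m let q_i, δ_i : ℕ → E and a_i, b_i : ℕ → ℝ. Let Δ : ℕ → E satisfy Δ(0) = 0 and, for every t, Δ(t+1) = Δ(t) − η • ∑_{i} ( a_i(t) • δ_i(t) + (b_i(t) · ⟪p(t), δ_i(t)⟫) • q_i(t) ). Assume for all t < T and all i: |a_i(t)| ≤ C1, |b_i(t)| ≤ C2, ‖δ_i(t)‖ ≤ γ^t · ‖δ_i(0)‖,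 and |⟪p(t), δ_i(t)⟫| · ‖q_i(t)‖ ≤ γ^t · |⟪p(0), δ_i(0)⟫| · ‖q_i(0)‖. Then ‖Δ(T)‖ ≤ ∑_{i} ( η·C1·‖δ_i(0)‖/(1 − γ) + η·C2·|⟪p(0), δ_i(0)⟫|·‖q_i(0)‖/(1 − γ) ). -/
open scoped RealInnerProductSpace BigOperators

theorem stmt9 {E : Type*} [NormedAddCommGroup E] [InnerProductSpace ℝ E]
    (m T : ℕ) (η γ C1 C2 : ℝ)
    (hη : 0 ≤ η) (hγ0 : 0 < γ) (hγ1 : γ < 1) (hC1 : 0 ≤ C1) (hC2 : 0 ≤ C2)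
    (p : ℕ → E) (q δ : Fin m → ℕ → E) (a b : Fin m → ℕ → ℝ)
    (Δ : ℕ → E) (hΔ0 : Δ 0 = 0)
    (hrec : ∀ t : ℕ,
      Δ (t + 1) = Δ t - η • ∑ i : Fin m,
        (a i t • δ i t + (b i t * ⟪p t, δ i t⟫) • q i t))
    (ha : ∀ t < T, ∀ i : Fin m, |a i t| ≤ C1)
    (hb : ∀ t < T, ∀ i : Fin m, |b i t| ≤ C2)
    (hδ : ∀ t < T, ∀ i : Fin m, ‖δ i t‖ ≤ γ ^ t * ‖δ i 0‖)
    (hq : ∀ t < T, ∀ i : Fin m,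
      |⟪p t, δ i t⟫| * ‖q i t‖ ≤ γ ^ t * |⟪p 0, δ i 0⟫| * ‖q i 0‖) :
    ‖Δ T‖ ≤ ∑ i : Fin m,
      (η * C1 * ‖δ i 0‖ / (1 - γ)
        + η * C2 * |⟪p 0, δ i 0⟫| * ‖q i 0‖ / (1 - γ)) := by
  have h1 : 0 < 1 - γ := by linarith
  set S : ℝ := ∑ i : Fin m,
      (η * C1 * ‖δ i 0‖ / (1 - γ)
        + η * C2 * |⟪p 0, δ i 0⟫| * ‖q i 0‖ / (1 - γ)) with hS
  have hS0 : 0 ≤ S := Finset.sum_nonneg fun i _ => by positivity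
  have step : ∀ t < T, ‖η • ∑ i : Fin m,
        (a i t • δ i t + (b i t * ⟪p t, δ i t⟫) • q i t)‖ ≤ γ ^ t * (1 - γ) * S := by
    intro t ht
    rw [norm_smul, Real.norm_of_nonneg hη]
    calc _ ≤ η * ∑ i : Fin m, (C1 * (γ ^ t * ‖δ i 0‖)
            + C2 * (γ ^ t * |⟪p 0, δ i 0⟫| * ‖q i 0‖)) := by
          refine mul_le_mul_of_nonneg_left ?_ hη
          refine norm_sum_le_of_le _ fun i _ => ?_
          refine norm_add_le_of_le ?_ ?_
          · rw [norm_smul, Real.norm_eq_abs]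
            exact mul_le_mul (ha t ht i) (hδ t ht i) (norm_nonneg _) hC1
          · rw [norm_smul, Real.norm_eq_abs, abs_mul, mul_assoc]
            exact mul_le_mul (hb t ht i) (hq t ht i) (by positivity) hC2
      _ = γ ^ t * (1 - γ) * S := by
          rw [hS, Finset.mul_sum, Finset.mul_sum]
          refine Finset.sum_congr rfl fun i _ => ?_
          field_simp
  have main : ∀ t ≤ T, ‖Δ t‖ ≤ (1 - γ ^ t) * S := by
    intro t
    induction t with
    | zero => intro _; simp [hΔ0]
    | succ t ih =>
      intro ht
      rw [hrec]
      have e1 := ih (by omega)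
      have e2 := step t (by omega)
      refine (norm_sub_le _ _).trans ((add_le_add e1 e2).trans (le_of_eq ?_))
      ring
  have := main T le_rfl
  have h2 : 0 ≤ γ ^ T * S := by positivity
  linarith
end

section
/- Let d be a natural number, p, q, δ ∈ EuclideanSpace ℝ (Fin d), r ∈ ℝ, and η ∈ ℝ. Set L1 = σ(⟪p, q⟫) − r and L2 = σ(⟪p, q⟫)·(1 − σ(⟪p, q⟫)), and let v = δ − (η·L1) • p. Then the calibrated user-embedding gradient decomposes as ‖ (σ(⟪p, q + v⟫) − r) • (q + v) − [ L1 • q + (L2·⟪p, δ⟫) • q + L1 • δ − (η·L1·L2·‖p‖²) • q − (η·L1²) • p ] ‖ ≤ (1/4)·|⟪p, v⟫|·‖v‖ + (⟪p, v⟫²/8)·(‖q‖ + ‖v‖). -/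
open scoped RealInnerProductSpace

lemma sg_eq : sigmoid = Real.sigmoid := by
  funext x
  rw [sigmoid, Real.sigmoid_def, one_div]

lemma sg_lip (x y : ℝ) : |Real.sigmoid x - Real.sigmoid y| ≤ 1 / 4 * |x - y| := by
  have h := Convex.norm_image_sub_le_of_norm_hasDerivWithin_le (f := Real.sigmoid)
    (f' := fun x => Real.sigmoid x * (1 - Real.sigmoid x)) (s := Set.univ) (C := 1 / 4)
    (x := y) (y := x)
    (fun z _ => (Real.hasDerivAt_sigmoid z).hasDerivWithinAt)
    (fun z _ => by
      have h0 := Real.sigmoid_pos z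
      have h1 := Real.sigmoid_lt_one z
      rw [Real.norm_eq_abs, abs_le]
      constructor <;> nlinarith [sq_nonneg (Real.sigmoid z - 1 / 2)])
    convex_univ (Set.mem_univ _) (Set.mem_univ _)
  simpa [Real.norm_eq_abs] using h

lemma sg_dlip (x y : ℝ) : |Real.sigmoid x * (1 - Real.sigmoid x)
    - Real.sigmoid y * (1 - Real.sigmoid y)| ≤ 1 / 4 * |x - y| := by
  refine le_trans ?_ (sg_lip x y)
  have e : Real.sigmoid x * (1 - Real.sigmoid x) - Real.sigmoid y * (1 - Real.sigmoid y)
      = (Real.sigmoid x - Real.sigmoid y) * (1 - Real.sigmoid x - Real.sigmoid y) := by ring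
  rw [e, abs_mul]
  refine mul_le_of_le_one_right (abs_nonneg _) ?_
  have := Real.sigmoid_pos x
  have := Real.sigmoid_lt_one x
  have := Real.sigmoid_pos y
  have := Real.sigmoid_lt_one y
  rw [abs_le]
  constructor <;> linarith

lemma taylor_aux (f f' : ℝ → ℝ) (hf : ∀ x, HasDerivAt f (f' x) x)
    (hb : ∀ x, |f' x - f' 0| ≤ 1 / 4 * |x|) (t : ℝ) (ht : 0 ≤ t) :
    |f t - f 0 - f' 0 * t| ≤ t ^ 2 / 8 := by
  have hg : ∀ x, HasDerivAt (fun x => f x - f 0 - f' 0 * x) (f' x - f' 0) x := by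
    intro x
    have h := ((hf x).sub_const (f 0)).sub ((hasDerivAt_id' x).const_mul (f' 0))
    rw [mul_one] at h
    exact h
  have hB : ∀ x : ℝ, HasDerivAt (fun x : ℝ => x ^ 2 / 8) (1 / 4 * x) x := by
    intro x
    have h := (hasDerivAt_pow 2 x).div_const 8
    have e : ((2 : ℕ) : ℝ) * x ^ (2 - 1) / 8 = 1 / 4 * x := by
      norm_num
      ring
    rw [e] at h
    exact h
  have := image_norm_le_of_norm_deriv_right_le_deriv_boundary
    (f := fun x => f x - f 0 - f' 0 * x) (f' := fun x => f' x - f' 0) (a := 0) (b := t)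
    (B := fun x : ℝ => x ^ 2 / 8) (B' := fun x => 1 / 4 * x)
    (fun x _ => (hg x).continuousAt.continuousWithinAt)
    (fun x _ => (hg x).hasDerivWithinAt) (by simp) hB
    (fun x hx => by
      have := hb x
      rwa [abs_of_nonneg hx.1] at this)
    (x := t) ⟨ht, le_rfl⟩
  simpa [Real.norm_eq_abs] using this

lemma sg_taylor (a t : ℝ) : |Real.sigmoid (a + t) - Real.sigmoid a
    - Real.sigmoid a * (1 - Real.sigmoid a) * t| ≤ t ^ 2 / 8 := by
  rcases le_total 0 t with ht | ht
  · have := taylor_aux (fun x => Real.sigmoid (a + x))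
      (fun x => Real.sigmoid (a + x) * (1 - Real.sigmoid (a + x)))
      (fun x => by simpa using (Real.hasDerivAt_sigmoid (a + x)).comp_const_add a x)
      (fun x => by simpa using sg_dlip (a + x) (a + 0)) t ht
    simpa using this
  · have := taylor_aux (fun x => Real.sigmoid (a - x))
      (fun x => - (Real.sigmoid (a - x) * (1 - Real.sigmoid (a - x))))
      (fun x => by simpa using (Real.hasDerivAt_sigmoid (a - x)).comp_const_sub a x)
      (fun x => by
        have := sg_dlip (a - 0) (a - x)
        convert this using 2 <;> ring_nf) (-t) (by linarith)
    simpa using this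

theorem stmt13 (d : ℕ) (p q δ : EuclideanSpace ℝ (Fin d)) (r η : ℝ)
    (L1 L2 : ℝ)
    (hL1 : L1 = sigmoid ⟪p, q⟫ - r)
    (hL2 : L2 = sigmoid ⟪p, q⟫ * (1 - sigmoid ⟪p, q⟫))
    (v : EuclideanSpace ℝ (Fin d)) (hv : v = δ - (η * L1) • p) :
    ‖(sigmoid ⟪p, q + v⟫ - r) • (q + v)
        - (L1 • q + (L2 * ⟪p, δ⟫) • q + L1 • δ
            - (η * L1 * L2 * ‖p‖ ^ 2) • q - (η * L1 ^ 2) • p)‖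
      ≤ (1 / 4) * |⟪p, v⟫| * ‖v‖ + (⟪p, v⟫ ^ 2 / 8) * (‖q‖ + ‖v‖) := by
  have h1 : ⟪p, q + v⟫ = ⟪p, q⟫ + ⟪p, v⟫ := inner_add_right _ _ _
  have h2 : ⟪p, v⟫ = ⟪p, δ⟫ - η * L1 * ‖p‖ ^ 2 := by
    rw [hv, inner_sub_right, inner_smul_right, real_inner_self_eq_norm_sq]
  have hd : δ = v + (η * L1) • p := by rw [hv]; abel
  have hT := sg_taylor ⟪p, q⟫ ⟪p, v⟫
  have hL := sg_lip (⟪p, q⟫ + ⟪p, v⟫) ⟪p, q⟫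
  rw [add_sub_cancel_left] at hL
  rw [sg_eq] at *
  rw [← hL2] at hT
  have h3 : ⟪p, δ⟫ = ⟪p, v⟫ + η * L1 * ‖p‖ ^ 2 := by linarith
  have hr : r = Real.sigmoid ⟪p, q⟫ - L1 := by linarith
  rw [h1, h3]
  generalize ⟪p, v⟫ = t at *
  generalize ⟪p, q⟫ = a at *
  have key : (Real.sigmoid (a + t) - r) • (q + v)
        - (L1 • q + (L2 * (t + η * L1 * ‖p‖ ^ 2)) • q + L1 • δ
            - (η * L1 * L2 * ‖p‖ ^ 2) • q - (η * L1 ^ 2) • p)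
      = (Real.sigmoid (a + t) - Real.sigmoid a - L2 * t) • q
        + (Real.sigmoid (a + t) - Real.sigmoid a) • v := by
    rw [hd, hr]
    module
  rw [key]
  refine (norm_add_le _ _).trans ?_
  rw [norm_smul, norm_smul, Real.norm_eq_abs, Real.norm_eq_abs]
  have e1 := mul_le_mul_of_nonneg_right hT (norm_nonneg q)
  have e2 := mul_le_mul_of_nonneg_right hL (norm_nonneg v)
  have e3 : 0 ≤ t ^ 2 / 8 * ‖v‖ := by positivity
  linarith
end
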